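/- (Sharp reverse Hölder inequality for A_∞.) There is a dimensional constant τ_n such that for every weight w ∈ A_∞, setting r_w = 1 + 1/(τ_n [w]_{A_∞}), one has for every cube Q: ((1/|Q|)∫_Q w^{r_w} dx)^{1/r_w} ≤ 2 (1/|Q|)∫_Q w dx. -/

import Mathlib

open MeasureTheory ENNReal NNReal

noncomputable section

/-- An axis-parallel cube in `ℝⁿ`. -/
def IsCube {n : ℕ} (Q : Set (Fin n → ℝ)) : Prop :=
  ∃ (a : Fin n → ℝ) (h : ℝ), 0 < h ∧ Q = {x | ∀ i, a i ≤ x i ∧ x i ≤ a i + h}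

/-- Average `(1/|Q|) ∫_Q f` of an `ℝ≥0∞`-valued function over a set. -/
def cubeAvg {n : ℕ} (f : (Fin n → ℝ) → ℝ≥0∞) (Q : Set (Fin n → ℝ)) : ℝ≥0∞ :=
  (∫⁻ x in Q, f x) / MeasureTheory.volume Q

/-- The uncentered Hardy–Littlewood maximal operator over axis-parallel cubes,
for `ℝ≥0∞`-valued functions. -/
def hlM {n : ℕ} (f : (Fin n → ℝ) → ℝ≥0∞) (x : Fin n → ℝ) : ℝ≥0∞ :=
  ⨆ (Q : Set (Fin n → ℝ)) (_ : IsCube Q) (_ : x ∈ Q), cubeAvg f Q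

/-- The Hardy–Littlewood maximal operator applied to a real-valued function:
`Mf(x) = sup_{Q ∋ x} (1/|Q|) ∫_Q |f|`. -/
def hlMR {n : ℕ} (f : (Fin n → ℝ) → ℝ) : (Fin n → ℝ) → ℝ≥0∞ :=
  hlM (fun y => ENNReal.ofReal |f y|)

/-- A weight: a locally integrable, a.e. positive function. -/
def IsWeight {n : ℕ} (w : (Fin n → ℝ) → ℝ) : Prop :=
  MeasureTheory.LocallyIntegrable w MeasureTheory.volume ∧
    ∀ᵐ x ∂(MeasureTheory.volume : MeasureTheory.Measure (Fin n → ℝ)), 0 < w x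

/-- `w(E) = ∫_E w dx`. -/
def wMeas {n : ℕ} (w : (Fin n → ℝ) → ℝ) (E : Set (Fin n → ℝ)) : ℝ≥0∞ :=
  ∫⁻ x in E, ENNReal.ofReal (w x)

/-- The `A₁` constant `[w]_{A₁} = ess sup_x M w(x) / w(x)`. -/
def a1Const {n : ℕ} (w : (Fin n → ℝ) → ℝ) : ℝ≥0∞ :=
  essSup (fun x => hlM (fun y => ENNReal.ofReal (w y)) x / ENNReal.ofReal (w x))
    MeasureTheory.volume

/-- The Fujii–Wilson `A_∞` constant `[w]_{A_∞} = sup_Q (1/∫_Q w) ∫_Q M(w·1_Q)`. -/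
def aInfConst {n : ℕ} (w : (Fin n → ℝ) → ℝ) : ℝ≥0∞ :=
  ⨆ (Q : Set (Fin n → ℝ)) (_ : IsCube Q),
    (∫⁻ x in Q, hlM (Q.indicator fun y => ENNReal.ofReal (w y)) x) / wMeas w Q

/-- The `A_p` constant, `1 < p < ∞`:
`[w]_{A_p} = sup_Q ⟨w⟩_Q (⟨w^{-1/(p-1)}⟩_Q)^{p-1}`. -/
def apConst {n : ℕ} (p : ℝ) (w : (Fin n → ℝ) → ℝ) : ℝ≥0∞ :=
  ⨆ (Q : Set (Fin n → ℝ)) (_ : IsCube Q),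
    cubeAvg (fun y => ENNReal.ofReal (w y)) Q *
      (cubeAvg (fun y => ENNReal.ofReal (w y) ^ (-(1 / (p - 1)))) Q) ^ (p - 1)

/-- The weak norm `‖g‖_{L^{1,∞}(σ)} = sup_{t>0} t · σ({x : g(x) > t})`
for an `ℝ≥0∞`-valued function `g` and a weight `σ`. -/
def wkNorm {n : ℕ} (g : (Fin n → ℝ) → ℝ≥0∞) (σ : (Fin n → ℝ) → ℝ) : ℝ≥0∞ :=
  ⨆ (t : ℝ≥0) (_ : 0 < t), (t : ℝ≥0∞) * wMeas σ {x | (t : ℝ≥0∞) < g x}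

/-- `‖f‖_{L¹(σ)} = ∫ |f| σ dx`. -/
def l1Norm {n : ℕ} (f : (Fin n → ℝ) → ℝ) (σ : (Fin n → ℝ) → ℝ) : ℝ≥0∞ :=
  ∫⁻ x, ENNReal.ofReal |f x| * ENNReal.ofReal (σ x)

/-- `‖g‖_{L^p(σ)} = (∫ g^p σ dx)^{1/p}` for an `ℝ≥0∞`-valued `g`. -/
def lpNormE {n : ℕ} (p : ℝ) (g : (Fin n → ℝ) → ℝ≥0∞) (σ : (Fin n → ℝ) → ℝ) : ℝ≥0∞ :=
  (∫⁻ x, g x ^ p * ENNReal.ofReal (σ x)) ^ (1 / p)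

/-- A bounded, compactly supported measurable function. -/
def BddCompSupp {n : ℕ} (f : (Fin n → ℝ) → ℝ) : Prop :=
  Measurable f ∧ (∃ C : ℝ, ∀ x, |f x| ≤ C) ∧ HasCompactSupport f

end

section FiberIntegral

variable {X ι : Type*} [MeasurableSpace X] [Countable ι] [MeasurableSpace ι]
  [MeasurableSingletonClass ι] {μ : MeasureTheory.Measure X} {p : X → ι}

theorem lintegral_eq_tsum_fiber (hp : Measurable p) (f : X → ℝ≥0∞) :
    ∫⁻ x, f x ∂μ = ∑' m, ∫⁻ x in p ⁻¹' {m}, f x ∂μ := by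
  rw [← lintegral_iUnion (fun m => hp (measurableSet_singleton m)), ← Set.preimage_iUnion,
    Set.iUnion_of_singleton, Set.preimage_univ, Measure.restrict_univ]
  intro i j hij
  exact Disjoint.preimage p (by simpa using hij)

/-- To compare two integrals against a weight that is constant on the fibers of `p`, it suffices to
compare them on every fiber where the weight does not vanish. -/
theorem lintegral_mul_le_of_fiber_le (hp : Measurable p) {f g u : X → ℝ≥0∞} {C : ℝ≥0∞}
    (hg : ∀ x y, p x = p y → g x = g y) (hg_top : ∀ x, g x ≠ ∞)
    (h : ∀ x, g x ≠ 0 →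
      ∫⁻ y in p ⁻¹' {p x}, f y ∂μ ≤ C * ∫⁻ y in p ⁻¹' {p x}, u y ∂μ) :
    ∫⁻ x, g x * f x ∂μ ≤ C * ∫⁻ x, g x * u x ∂μ := by
  rw [lintegral_eq_tsum_fiber hp, lintegral_eq_tsum_fiber hp (fun x => g x * u x),
    ← ENNReal.tsum_mul_left]
  refine ENNReal.tsum_le_tsum fun m => ?_
  have hm : MeasurableSet (p ⁻¹' {m}) := hp (measurableSet_singleton m)
  rcases (p ⁻¹' {m}).eq_empty_or_nonempty with he | ⟨x, rfl⟩
  · simp [he]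
  · have key : ∀ F : X → ℝ≥0∞, ∫⁻ y in p ⁻¹' {p x}, g y * F y ∂μ =
        g x * ∫⁻ y in p ⁻¹' {p x}, F y ∂μ := fun F => by
      rw [← lintegral_const_mul' _ _ (hg_top x)]
      exact setLIntegral_congr_fun hm fun y hy => by simp only [hg y x hy]
    rw [key, key, mul_left_comm]
    by_cases h0 : g x = 0
    · simp [h0]
    · gcongr
      exact h x h0

theorem measurable_of_fiber_const (hp : Measurable p) {β : Type*} [MeasurableSpace β] {f : X → β}
    (hf : ∀ x y, p x = p y → f x = f y) : Measurable f := by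
  intro s _
  have : f ⁻¹' s = p ⁻¹' (p '' (f ⁻¹' s)) := by
    refine (Set.subset_preimage_image _ _).antisymm ?_
    rintro x ⟨y, hy, hyx⟩
    rw [Set.mem_preimage, ← hf y x hyx]
    exact hy
  rw [this]
  exact hp (Set.to_countable _).measurableSet

end FiberIntegral

noncomputable section DyadicGrid

variable {n : ℕ} (a : Fin n → ℝ) (h : ℝ)

/-- The index of the half-open cube of side `h / 2 ^ k`, in the grid with origin `a`, which
contains `x`. -/
def dyadicIndex (k : ℕ) (x : Fin n → ℝ) : Fin n → ℤ := fun i => ⌊(x i - a i) / (h / 2 ^ k)⌋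

/-- The closed cube with index `m` and side `h / 2 ^ k` in the grid with origin `a`. -/
def dyadicCube (k : ℕ) (m : Fin n → ℤ) : Set (Fin n → ℝ) :=
  Set.Icc (fun i => a i + m i * (h / 2 ^ k)) (fun i => a i + m i * (h / 2 ^ k) + h / 2 ^ k)

/-- The average of `v` over the closed cube of generation `k` containing `x`. -/
def dyadicAvg (v : (Fin n → ℝ) → ℝ≥0∞) (k : ℕ) (x : Fin n → ℝ) : ℝ≥0∞ :=
  cubeAvg v (dyadicCube a h k (dyadicIndex a h k x))

/-- The dyadic maximal function of `v` which uses only the generations `0, …, k`, localised to the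
base cube of the grid. -/
def dyadicMax (v : (Fin n → ℝ) → ℝ≥0∞) : ℕ → (Fin n → ℝ) → ℝ≥0∞
  | 0 => (dyadicIndex a h 0 ⁻¹' {0}).indicator (dyadicAvg a h v 0)
  | k + 1 => fun x =>
      max (dyadicMax v k x) ((dyadicIndex a h 0 ⁻¹' {0}).indicator (dyadicAvg a h v (k + 1)) x)

variable {a h}

theorem measurable_dyadicIndex (k : ℕ) : Measurable (dyadicIndex a h k) := by
  refine measurable_pi_lambda _ fun i => Int.measurable_floor.comp ?_
  fun_prop

theorem dyadicIndex_eq_half (k : ℕ) (x : Fin n → ℝ) :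
    dyadicIndex a h k x = fun i => dyadicIndex a h (k + 1) x i / 2 := by
  funext i
  have := Int.floor_div_natCast ((x i - a i) / (h / 2 ^ (k + 1))) 2
  simp only [dyadicIndex]
  push_cast at this
  rw [← this]
  congr 1
  rw [pow_succ]
  field_simp

theorem dyadicIndex_congr {j k : ℕ} (hjk : j ≤ k) {x y : Fin n → ℝ}
    (hxy : dyadicIndex a h k x = dyadicIndex a h k y) :
    dyadicIndex a h j x = dyadicIndex a h j y := by
  induction k, hjk using Nat.le_induction with
  | base => exact hxy
  | succ k _ ih => exact ih (by rw [dyadicIndex_eq_half k x, dyadicIndex_eq_half k y, hxy])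

theorem isCube_dyadicCube (hh : 0 < h) (k : ℕ) (m : Fin n → ℤ) : IsCube (dyadicCube a h k m) :=
  ⟨fun i => a i + m i * (h / 2 ^ k), h / 2 ^ k, by positivity, by
    ext x; simp [dyadicCube, Pi.le_def, forall_and]⟩

theorem dyadicIndex_preimage (hh : 0 < h) (k : ℕ) (m : Fin n → ℤ) :
    dyadicIndex a h k ⁻¹' {m} = Set.univ.pi fun i =>
      Set.Ico (a i + m i * (h / 2 ^ k)) (a i + m i * (h / 2 ^ k) + h / 2 ^ k) := by
  ext x
  have hs : 0 < h / 2 ^ k := by positivity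
  simp only [Set.mem_preimage, Set.mem_singleton_iff, funext_iff, dyadicIndex, Int.floor_eq_iff,
    Set.mem_univ_pi, Set.mem_Ico, le_div_iff₀ hs, div_lt_iff₀ hs]
  refine forall_congr' fun i => and_congr ?_ ?_ <;> constructor <;> intro _ <;> linarith

theorem dyadicIndex_preimage_subset (hh : 0 < h) (k : ℕ) (m : Fin n → ℤ) :
    dyadicIndex a h k ⁻¹' {m} ⊆ dyadicCube a h k m := by
  rw [dyadicIndex_preimage hh, dyadicCube, ← Set.pi_univ_Icc]
  exact Set.pi_mono fun i _ => Set.Ico_subset_Icc_self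

theorem mem_dyadicCube (hh : 0 < h) (k : ℕ) (x : Fin n → ℝ) :
    x ∈ dyadicCube a h k (dyadicIndex a h k x) :=
  dyadicIndex_preimage_subset hh k _ rfl

theorem dyadicIndex_preimage_ae_eq (hh : 0 < h) (k : ℕ) (m : Fin n → ℤ) :
    (dyadicIndex a h k ⁻¹' {m} : Set (Fin n → ℝ)) =ᵐ[volume] dyadicCube a h k m := by
  rw [dyadicIndex_preimage hh]
  exact Measure.univ_pi_Ico_ae_eq_Icc

theorem volume_dyadicCube (k : ℕ) (m : Fin n → ℤ) :
    volume (dyadicCube a h k m) = ENNReal.ofReal (h / 2 ^ k) ^ n := by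
  simp [dyadicCube, Real.volume_Icc_pi]

theorem volume_dyadicCube_ne_zero (hh : 0 < h) (k : ℕ) (m : Fin n → ℤ) :
    volume (dyadicCube a h k m) ≠ 0 := by
  rw [volume_dyadicCube]
  exact pow_ne_zero _ (by simp only [ne_eq, ENNReal.ofReal_eq_zero, not_le]; positivity)

theorem volume_dyadicCube_ne_top (k : ℕ) (m : Fin n → ℤ) :
    volume (dyadicCube a h k m) ≠ ∞ := by
  rw [volume_dyadicCube]
  exact ENNReal.pow_ne_top ENNReal.ofReal_ne_top

theorem dyadicCube_subset_half (hh : 0 < h) (k : ℕ) (m : Fin n → ℤ) :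
    dyadicCube a h (k + 1) m ⊆ dyadicCube a h k fun i => m i / 2 := by
  have hs : 0 < h / 2 ^ (k + 1) := by positivity
  have hs2 : h / 2 ^ k = 2 * (h / 2 ^ (k + 1)) := by rw [pow_succ]; field_simp
  refine Set.Icc_subset_Icc (fun i => ?_) (fun i => ?_)
  · have : ((2 * (m i / 2) : ℤ) : ℝ) ≤ m i := by exact_mod_cast (by omega)
    push_cast at this
    simp only [hs2]
    nlinarith
  · have : ((m i + 1 : ℤ) : ℝ) ≤ (2 * (m i / 2) + 2 : ℤ) := by exact_mod_cast (by omega)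
    push_cast at this
    simp only [hs2]
    nlinarith

theorem dyadicCube_subset (hh : 0 < h) {j k : ℕ} (hjk : j ≤ k) (x : Fin n → ℝ) :
    dyadicCube a h k (dyadicIndex a h k x) ⊆ dyadicCube a h j (dyadicIndex a h j x) := by
  induction k, hjk using Nat.le_induction with
  | base => exact subset_rfl
  | succ k _ ih =>
    refine Set.Subset.trans ?_ ih
    rw [dyadicIndex_eq_half k x]
    exact dyadicCube_subset_half hh k _

theorem dyadicCube_eq_closedBall (hh : 0 < h) (k : ℕ) (m : Fin n → ℤ) :
    dyadicCube a h k m =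
      Metric.closedBall (fun i => a i + m i * (h / 2 ^ k) + h / 2 ^ k / 2) (h / 2 ^ k / 2) := by
  ext x
  have hs : 0 < h / 2 ^ k / 2 := by positivity
  simp only [dyadicCube, Set.mem_Icc, Pi.le_def, Metric.mem_closedBall, dist_pi_le_iff hs.le,
    Real.dist_eq, abs_le, ← forall_and]
  refine forall_congr' fun i => ?_
  constructor <;> rintro ⟨_, _⟩ <;> constructor <;> linarith

variable {v : (Fin n → ℝ) → ℝ≥0∞}

theorem dyadicAvg_succ_le (hh : 0 < h) (k : ℕ) (x : Fin n → ℝ) :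
    dyadicAvg a h v (k + 1) x ≤ 2 ^ n * dyadicAvg a h v k x := by
  have hvol : (2 : ℝ≥0∞) ^ n * volume (dyadicCube a h (k + 1) (dyadicIndex a h (k + 1) x)) =
      volume (dyadicCube a h k (dyadicIndex a h k x)) := by
    rw [volume_dyadicCube, volume_dyadicCube, ← mul_pow,
      ← ENNReal.ofReal_ofNat, ← ENNReal.ofReal_mul (by norm_num)]
    congr 2
    rw [pow_succ]
    field_simp
  rw [dyadicAvg, dyadicAvg, cubeAvg, cubeAvg, ← hvol, ← mul_div_assoc,
    ENNReal.mul_div_mul_left _ _ (by simp) (by simp)]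
  gcongr
  exact dyadicCube_subset hh k.le_succ x

theorem dyadicAvg_ne_top (hh : 0 < h) (hv : ∀ Q, IsCube Q → ∫⁻ y in Q, v y ≠ ∞) (k : ℕ)
    (x : Fin n → ℝ) : dyadicAvg a h v k x ≠ ∞ :=
  ENNReal.div_ne_top (hv _ (isCube_dyadicCube hh _ _)) (volume_dyadicCube_ne_zero hh _ _)

theorem setLIntegral_dyadicAvg (hh : 0 < h) (k : ℕ) (x : Fin n → ℝ) :
    ∫⁻ y in dyadicIndex a h k ⁻¹' {dyadicIndex a h k x}, dyadicAvg a h v k y =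
      ∫⁻ y in dyadicIndex a h k ⁻¹' {dyadicIndex a h k x}, v y := by
  have : ∫⁻ y in dyadicIndex a h k ⁻¹' {dyadicIndex a h k x}, dyadicAvg a h v k y =
      ∫⁻ _ in dyadicIndex a h k ⁻¹' {dyadicIndex a h k x}, dyadicAvg a h v k x :=
    setLIntegral_congr_fun (measurable_dyadicIndex k (measurableSet_singleton _)) fun y hy => by
      rw [dyadicAvg, dyadicAvg, Set.mem_singleton_iff.1 hy]
  rw [this, setLIntegral_const, measure_congr (dyadicIndex_preimage_ae_eq hh k _),
    setLIntegral_congr (dyadicIndex_preimage_ae_eq hh k _), dyadicAvg, cubeAvg,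
    ENNReal.div_mul_cancel (volume_dyadicCube_ne_zero hh _ _) (volume_dyadicCube_ne_top _ _)]

theorem ae_tendsto_dyadicAvg (hh : 0 < h) (hvm : AEMeasurable v)
    (hv : ∀ Q, IsCube Q → ∫⁻ y in Q, v y ≠ ∞) :
    ∀ᵐ x, x ∈ dyadicIndex a h 0 ⁻¹' {0} →
      Filter.Tendsto (fun k => dyadicAvg a h v k x) Filter.atTop (nhds (v x)) := by
  have hm : MeasurableSet (dyadicCube a h 0 0) := measurableSet_Icc
  have key := (IsUnifLocDoublingMeasure.vitaliFamily
    (volume : Measure (Fin n → ℝ)) 1).ae_tendsto_lintegral_div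
    (f := (dyadicCube a h 0 0).indicator v) (hvm.indicator hm)
    (by rw [lintegral_indicator hm]; exact hv _ (isCube_dyadicCube hh _ _))
  filter_upwards [key] with x hx hxQ
  have hs : Filter.Tendsto (fun k : ℕ => h / 2 ^ k / 2) Filter.atTop (nhdsWithin 0 (Set.Ioi 0)) := by
    refine tendsto_nhdsWithin_iff.2 ⟨?_, .of_forall fun k => by
      simp only [Set.mem_Ioi]; positivity⟩
    have := (tendsto_pow_atTop_nhds_zero_of_lt_one (r := (1 / 2 : ℝ)) (by norm_num)
      (by norm_num)).const_mul (h / 2)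
    simp only [mul_zero] at this
    refine this.congr fun k => ?_
    rw [one_div, inv_pow]
    field_simp
  have hball := IsUnifLocDoublingMeasure.tendsto_closedBall_filterAt
    (μ := (volume : Measure (Fin n → ℝ))) (K := 1) (x := x)
    (fun k i => a i + dyadicIndex a h k x i * (h / 2 ^ k) + h / 2 ^ k / 2) _ hs
    (.of_forall fun k => by
      rw [one_mul, ← dyadicCube_eq_closedBall hh]
      exact mem_dyadicCube hh k x)
  have hlim := hx.comp hball
  rw [Set.indicator_of_mem (dyadicIndex_preimage_subset hh 0 0 hxQ)] at hlim
  refine hlim.congr fun k => ?_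
  rw [Function.comp_apply, ← dyadicCube_eq_closedBall hh, dyadicAvg, cubeAvg]
  congr 1
  refine setLIntegral_congr_fun measurableSet_Icc fun y hy => Set.indicator_of_mem ?_ v
  have := dyadicCube_subset hh k.zero_le x hy
  rwa [Set.mem_singleton_iff.1 hxQ] at this

theorem dyadicMax_congr {k : ℕ} {x y : Fin n → ℝ}
    (hxy : dyadicIndex a h k x = dyadicIndex a h k y) :
    dyadicMax a h v k x = dyadicMax a h v k y := by
  have hind : (dyadicIndex a h 0 ⁻¹' {0}).indicator (dyadicAvg a h v k) x =
      (dyadicIndex a h 0 ⁻¹' {0}).indicator (dyadicAvg a h v k) y := by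
    simp only [Set.indicator, Set.mem_preimage, dyadicIndex_congr k.zero_le hxy, dyadicAvg, hxy]
  induction k with
  | zero => exact hind
  | succ k ih =>
    have hk := dyadicIndex_congr k.le_succ hxy
    simp only [dyadicMax]
    rw [hind, ih hk]
    simp only [Set.indicator, Set.mem_preimage, dyadicIndex_congr k.zero_le hk, dyadicAvg, hk]

theorem measurable_dyadicMax (k : ℕ) : Measurable (dyadicMax a h v k) :=
  measurable_of_fiber_const (measurable_dyadicIndex k) fun _ _ => dyadicMax_congr

theorem dyadicMax_le_succ (k : ℕ) (x : Fin n → ℝ) :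
    dyadicMax a h v k x ≤ dyadicMax a h v (k + 1) x :=
  le_max_left _ _

theorem indicator_dyadicAvg_le_dyadicMax (k : ℕ) (x : Fin n → ℝ) :
    (dyadicIndex a h 0 ⁻¹' {0}).indicator (dyadicAvg a h v k) x ≤ dyadicMax a h v k x := by
  cases k with
  | zero => exact le_rfl
  | succ k => exact le_max_right _ _

theorem dyadicMax_succ_le (hh : 0 < h) (k : ℕ) (x : Fin n → ℝ) :
    dyadicMax a h v (k + 1) x ≤ 2 ^ n * dyadicMax a h v k x := by
  refine max_le (le_mul_of_one_le_left' (one_le_pow₀ one_le_two)) ?_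
  refine le_trans ?_ (mul_le_mul_right (indicator_dyadicAvg_le_dyadicMax k x) (2 ^ n))
  by_cases hx : x ∈ dyadicIndex a h 0 ⁻¹' {0}
  · simpa only [Set.indicator_of_mem hx] using dyadicAvg_succ_le hh k x
  · simp [Set.indicator_of_notMem hx]

theorem dyadicMax_le_zero (hh : 0 < h) (k : ℕ) (x : Fin n → ℝ) :
    dyadicMax a h v k x ≤ (2 ^ n) ^ k * dyadicMax a h v 0 x := by
  induction k with
  | zero => simp
  | succ k ih =>
    rw [pow_succ', mul_assoc]
    exact (dyadicMax_succ_le hh k x).trans (by gcongr)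

theorem dyadicMax_ne_top (hh : 0 < h) (hv : ∀ Q, IsCube Q → ∫⁻ y in Q, v y ≠ ∞) (k : ℕ)
    (x : Fin n → ℝ) : dyadicMax a h v k x ≠ ∞ :=
  ne_top_of_le_ne_top (ENNReal.mul_ne_top (by finiteness) (ne_top_of_le_ne_top
    (dyadicAvg_ne_top hh hv 0 x) (Set.indicator_le_self _ _ x))) (dyadicMax_le_zero hh k x)

theorem dyadicAvg_le_hlM (hh : 0 < h) {j k : ℕ} (hjk : j ≤ k) (x : Fin n → ℝ) :
    dyadicAvg a h v k x ≤
      hlM ((dyadicCube a h j (dyadicIndex a h j x)).indicator v) x := by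
  have : dyadicAvg a h v k x = cubeAvg ((dyadicCube a h j (dyadicIndex a h j x)).indicator v)
      (dyadicCube a h k (dyadicIndex a h k x)) := by
    rw [dyadicAvg, cubeAvg, cubeAvg]
    congr 1
    exact setLIntegral_congr_fun measurableSet_Icc fun y hy =>
      (Set.indicator_of_mem (dyadicCube_subset hh hjk x hy) v).symm
  rw [this]
  exact le_iSup₂_of_le _ (isCube_dyadicCube hh k _) (le_iSup_of_le (mem_dyadicCube hh k x) le_rfl)

theorem dyadicMax_le_hlM (hh : 0 < h) {j k : ℕ} (hjk : j ≤ k) {x : Fin n → ℝ}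
    (hx : dyadicMax a h v j x ≤ dyadicAvg a h v j x) :
    dyadicMax a h v k x ≤
      hlM ((dyadicCube a h j (dyadicIndex a h j x)).indicator v) x := by
  induction k, hjk using Nat.le_induction with
  | base => exact hx.trans (dyadicAvg_le_hlM hh le_rfl x)
  | succ k hk ih =>
    exact max_le ih ((Set.indicator_le_self _ _ x).trans (dyadicAvg_le_hlM hh (by omega) x))

theorem Real.rpow_sub_rpow_mul_le {D ε s t : ℝ} (hε : 0 ≤ ε) (hε1 : ε ≤ 1) (hs : 0 ≤ s)
    (hst : s ≤ t) (htD : t ≤ D * s) :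
    (t ^ ε - s ^ ε) * t + D * ε * (s ^ ε * s) ≤ D * ε * (t ^ ε * t) := by
  rcases hs.eq_or_lt with rfl | hs
  · obtain rfl : t = 0 := le_antisymm (by simpa using htD) hst
    simp
  have ht : 0 < t := hs.trans_le hst
  have hD : 0 ≤ D := by
    by_contra! hD
    nlinarith
  have hsε : 0 < s ^ ε := by positivity
  have hmono : s ^ ε ≤ t ^ ε := by gcongr
  have hbern : t ^ ε ≤ s ^ ε * (1 + ε * ((t - s) / s)) := by
    have h1 := rpow_one_add_le_one_add_mul_self (s := (t - s) / s)
      (by have : 0 ≤ (t - s) / s := div_nonneg (by linarith) hs.le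
          linarith) hε hε1
    have h2 : t = s * (1 + (t - s) / s) := by field_simp; ring
    calc t ^ ε = s ^ ε * (1 + (t - s) / s) ^ ε := by
          conv_lhs => rw [h2]
          rw [Real.mul_rpow hs.le (by rw [show 1 + (t - s) / s = t / s by field_simp; ring]
                                      positivity)]
      _ ≤ _ := by gcongr
  have hdiff : (t ^ ε - s ^ ε) * s ≤ s ^ ε * (ε * (t - s)) := by
    have := mul_le_mul_of_nonneg_right hbern hs.le
    have h3 : s ^ ε * (1 + ε * ((t - s) / s)) * s = s ^ ε * s + s ^ ε * (ε * (t - s)) := by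
      field_simp
    linarith
  calc (t ^ ε - s ^ ε) * t + D * ε * (s ^ ε * s)
      ≤ (t ^ ε - s ^ ε) * (D * s) + D * ε * (s ^ ε * s) := by
        gcongr
    _ = D * ((t ^ ε - s ^ ε) * s) + D * ε * (s ^ ε * s) := by ring
    _ ≤ D * (s ^ ε * (ε * (t - s))) + D * ε * (s ^ ε * s) := by gcongr
    _ = D * ε * (s ^ ε * t) := by ring
    _ ≤ D * ε * (t ^ ε * t) := by gcongr

theorem ENNReal.rpow_sub_rpow_mul_le {D ε : ℝ} {s t : ℝ≥0∞} (hD : 0 ≤ D) (hε : 0 ≤ ε)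
    (hε1 : ε ≤ 1) (ht : t ≠ ∞) (hst : s ≤ t) (htD : t ≤ ENNReal.ofReal D * s) :
    (t ^ ε - s ^ ε) * t + ENNReal.ofReal (D * ε) * (s ^ ε * s) ≤
      ENNReal.ofReal (D * ε) * (t ^ ε * t) := by
  have hs : s ≠ ∞ := ne_top_of_le_ne_top ht hst
  obtain ⟨t, ht0, rfl⟩ : ∃ r : ℝ, 0 ≤ r ∧ t = ENNReal.ofReal r :=
    ⟨t.toReal, ENNReal.toReal_nonneg, (ENNReal.ofReal_toReal ht).symm⟩
  obtain ⟨s, hs0, rfl⟩ : ∃ r : ℝ, 0 ≤ r ∧ s = ENNReal.ofReal r :=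
    ⟨s.toReal, ENNReal.toReal_nonneg, (ENNReal.ofReal_toReal hs).symm⟩
  rw [← ENNReal.ofReal_mul hD, ENNReal.ofReal_le_ofReal_iff (by positivity)] at htD
  rw [ENNReal.ofReal_le_ofReal_iff ht0] at hst
  have hsub : 0 ≤ t ^ ε - s ^ ε := sub_nonneg.2 (by gcongr)
  rw [ENNReal.ofReal_rpow_of_nonneg ht0 hε, ENNReal.ofReal_rpow_of_nonneg hs0 hε,
    ← ENNReal.ofReal_sub _ (by positivity), ← ENNReal.ofReal_mul hsub,
    ← ENNReal.ofReal_mul (by positivity), ← ENNReal.ofReal_mul (by positivity),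
    ← ENNReal.ofReal_mul (by positivity), ← ENNReal.ofReal_mul (by positivity),
    ← ENNReal.ofReal_add (by positivity) (by positivity)]
  exact ENNReal.ofReal_le_ofReal (Real.rpow_sub_rpow_mul_le hε hε1 hs0 hst htD)

theorem measurable_dyadicMax_rpow (ε : ℝ) (k : ℕ) :
    Measurable fun x => dyadicMax a h v k x ^ ε :=
  (measurable_dyadicMax k).pow_const ε

theorem dyadicMax_rpow_add_tsub {ε : ℝ} (hε : 0 ≤ ε) (k : ℕ) (x : Fin n → ℝ) :
    dyadicMax a h v k x ^ ε + (dyadicMax a h v (k + 1) x ^ ε - dyadicMax a h v k x ^ ε) =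
      dyadicMax a h v (k + 1) x ^ ε :=
  add_tsub_cancel_of_le (ENNReal.rpow_le_rpow (dyadicMax_le_succ k x) hε)

theorem lintegral_dyadicMax_succ_rpow_mul {ε : ℝ} (hε : 0 ≤ ε) (k : ℕ)
    {u : (Fin n → ℝ) → ℝ≥0∞} (hu : AEMeasurable u) :
    ∫⁻ x, dyadicMax a h v (k + 1) x ^ ε * u x =
      (∫⁻ x, dyadicMax a h v k x ^ ε * u x) +
        ∫⁻ x, (dyadicMax a h v (k + 1) x ^ ε - dyadicMax a h v k x ^ ε) * u x := by
  have hm : AEMeasurable (fun x => dyadicMax a h v k x ^ ε * u x) :=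
    (measurable_dyadicMax_rpow ε k).aemeasurable.mul hu
  rw [← lintegral_add_left' hm]
  exact lintegral_congr fun x => by rw [← add_mul, dyadicMax_rpow_add_tsub hε]

theorem dyadicMax_rpow_tsub_congr (ε : ℝ) (k : ℕ) (x y : Fin n → ℝ)
    (hxy : dyadicIndex a h (k + 1) x = dyadicIndex a h (k + 1) y) :
    dyadicMax a h v (k + 1) x ^ ε - dyadicMax a h v k x ^ ε =
      dyadicMax a h v (k + 1) y ^ ε - dyadicMax a h v k y ^ ε := by
  rw [dyadicMax_congr hxy, dyadicMax_congr (dyadicIndex_congr k.le_succ hxy)]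

theorem dyadicMax_succ_le_of_tsub_ne_zero {ε : ℝ} (hε : 0 ≤ ε) {k : ℕ} {x : Fin n → ℝ}
    (hx : dyadicMax a h v (k + 1) x ^ ε - dyadicMax a h v k x ^ ε ≠ 0) :
    dyadicMax a h v (k + 1) x ≤ dyadicAvg a h v (k + 1) x := by
  refine le_trans ?_ (Set.indicator_le_self (dyadicIndex a h 0 ⁻¹' {0}) _ x)
  by_contra! hlt
  refine hx (tsub_eq_zero_of_le (ENNReal.rpow_le_rpow ?_ hε))
  rw [dyadicMax] at hlt ⊢
  rcases lt_max_iff.1 hlt with h1 | h1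
  · exact max_le le_rfl h1.le
  · exact absurd h1 (lt_irrefl _)

theorem lintegral_dyadicMax_rpow_mul_le_add (hh : 0 < h) (hvm : AEMeasurable v)
    (hv : ∀ Q, IsCube Q → ∫⁻ y in Q, v y ≠ ∞) {ε : ℝ} (hε : 0 ≤ ε) (hε1 : ε ≤ 1) (k : ℕ) :
    ∫⁻ x, dyadicMax a h v k x ^ ε * v x ≤ (∫⁻ x, dyadicMax a h v 0 x ^ ε * v x) +
      ENNReal.ofReal (2 ^ n * ε) * ∫⁻ x, dyadicMax a h v k x ^ ε * dyadicMax a h v k x := by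
  have hm : ∀ j, Measurable fun x => dyadicMax a h v j x ^ ε * dyadicMax a h v j x :=
    fun j => (measurable_dyadicMax_rpow ε j).mul (measurable_dyadicMax j)
  induction k with
  | zero => exact le_self_add
  | succ k ih =>
    rw [lintegral_dyadicMax_succ_rpow_mul hε k hvm]
    refine (add_le_add_left ih _).trans ?_
    rw [add_assoc]
    refine add_le_add_right ?_ _
    rw [add_comm]
    have hstep : ∫⁻ x, (dyadicMax a h v (k + 1) x ^ ε - dyadicMax a h v k x ^ ε) * v x ≤
        ∫⁻ x, (dyadicMax a h v (k + 1) x ^ ε - dyadicMax a h v k x ^ ε) *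
          dyadicMax a h v (k + 1) x := by
      refine (lintegral_mul_le_of_fiber_le (C := 1) (u := dyadicMax a h v (k + 1))
        (measurable_dyadicIndex (a := a) (h := h) (k + 1))
        (dyadicMax_rpow_tsub_congr ε k) (fun x => ?_) fun x hx => ?_).trans_eq (one_mul _)
      · exact ne_top_of_le_ne_top (ENNReal.rpow_ne_top_of_nonneg hε
          (dyadicMax_ne_top hh hv _ x)) tsub_le_self
      · have hxQ : x ∈ dyadicIndex a h 0 ⁻¹' {0} := by
          by_contra hxQ
          have hx0 : dyadicMax a h v (k + 1) x = 0 := by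
            have := dyadicMax_le_zero (a := a) (v := v) hh (k + 1) x
            rwa [show dyadicMax a h v 0 x = 0 from Set.indicator_of_notMem hxQ _, mul_zero,
              nonpos_iff_eq_zero] at this
          refine hx (tsub_eq_zero_of_le (ENNReal.rpow_le_rpow ?_ hε))
          rw [hx0]
          exact zero_le
        rw [one_mul, ← setLIntegral_dyadicAvg hh]
        refine setLIntegral_mono (measurable_dyadicMax _) fun y hy => ?_
        refine le_trans (le_of_eq ?_) (indicator_dyadicAvg_le_dyadicMax (k + 1) y)
        rw [Set.indicator_of_mem]
        exact (dyadicIndex_congr (Nat.zero_le _) hy).trans hxQ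
    refine (add_le_add_left hstep _).trans ?_
    rw [← lintegral_const_mul _ (hm k), ← lintegral_const_mul _ (hm (k + 1)),
      ← lintegral_add_right _ ((hm k).const_mul _)]
    refine lintegral_mono fun x => ENNReal.rpow_sub_rpow_mul_le (by positivity) hε hε1
      (dyadicMax_ne_top hh hv _ x) (dyadicMax_le_succ k x) ?_
    rw [ENNReal.ofReal_pow (by norm_num), ENNReal.ofReal_ofNat]
    exact dyadicMax_succ_le hh k x

theorem setLIntegral_dyadicMax_le (hh : 0 < h) {A : ℝ≥0∞}
    (hA : ∀ Q, IsCube Q → ∫⁻ x in Q, hlM (Q.indicator v) x ≤ A * ∫⁻ x in Q, v x) {j k : ℕ}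
    (hjk : j ≤ k) {x : Fin n → ℝ} (hx : dyadicMax a h v j x ≤ dyadicAvg a h v j x) :
    ∫⁻ y in dyadicIndex a h j ⁻¹' {dyadicIndex a h j x}, dyadicMax a h v k y ≤
      A * ∫⁻ y in dyadicIndex a h j ⁻¹' {dyadicIndex a h j x}, v y := by
  rw [setLIntegral_congr (dyadicIndex_preimage_ae_eq hh j _) (f := v)]
  refine le_trans ?_ (hA _ (isCube_dyadicCube hh _ _))
  refine le_trans ?_ (lintegral_mono_set (dyadicIndex_preimage_subset hh j _))
  refine setLIntegral_mono' (measurable_dyadicIndex j (measurableSet_singleton _)) fun y hy => ?_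
  have hyx : dyadicIndex a h j y = dyadicIndex a h j x := hy
  rw [← hyx]
  refine dyadicMax_le_hlM hh hjk ?_
  rwa [dyadicMax_congr hyx, dyadicAvg, hyx]

theorem lintegral_dyadicMax_rpow_mul_dyadicMax_le (hh : 0 < h) (hvm : AEMeasurable v)
    (hv : ∀ Q, IsCube Q → ∫⁻ y in Q, v y ≠ ∞) {A : ℝ≥0∞}
    (hA : ∀ Q, IsCube Q → ∫⁻ x in Q, hlM (Q.indicator v) x ≤ A * ∫⁻ x in Q, v x)
    {ε : ℝ} (hε : 0 ≤ ε) {j k : ℕ} (hjk : j ≤ k) :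
    ∫⁻ x, dyadicMax a h v j x ^ ε * dyadicMax a h v k x ≤
      A * ∫⁻ x, dyadicMax a h v j x ^ ε * v x := by
  have htop : ∀ i x, dyadicMax a h v i x ^ ε ≠ ∞ := fun i x =>
    ENNReal.rpow_ne_top_of_nonneg hε (dyadicMax_ne_top hh hv i x)
  induction j with
  | zero =>
    exact lintegral_mul_le_of_fiber_le (measurable_dyadicIndex (a := a) (h := h) 0)
      (fun x y hxy => by rw [dyadicMax_congr hxy]) (htop 0)
      fun x _ => setLIntegral_dyadicMax_le hh hA hjk (Set.indicator_le_self _ _ x)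
  | succ j ih =>
    rw [lintegral_dyadicMax_succ_rpow_mul hε j hvm, lintegral_dyadicMax_succ_rpow_mul hε j
      (measurable_dyadicMax k).aemeasurable, mul_add]
    refine add_le_add (ih (by omega)) ?_
    exact lintegral_mul_le_of_fiber_le (measurable_dyadicIndex (a := a) (h := h) (j + 1))
      (dyadicMax_rpow_tsub_congr ε j)
      (fun x => ne_top_of_le_ne_top (htop (j + 1) x) tsub_le_self)
      fun x hx => setLIntegral_dyadicMax_le hh hA hjk (dyadicMax_succ_le_of_tsub_ne_zero hε hx)

theorem dyadicMax_zero_rpow_mul {ε : ℝ} (hε : 0 < ε) (x : Fin n → ℝ) :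
    dyadicMax a h v 0 x ^ ε * v x =
      (dyadicIndex a h 0 ⁻¹' {0}).indicator
        (fun y => cubeAvg v (dyadicCube a h 0 0) ^ ε * v y) x := by
  by_cases hx : x ∈ dyadicIndex a h 0 ⁻¹' {0}
  · rw [dyadicMax, Set.indicator_of_mem hx, Set.indicator_of_mem hx, dyadicAvg,
      Set.mem_singleton_iff.1 hx]
  · rw [dyadicMax, Set.indicator_of_notMem hx, Set.indicator_of_notMem hx,
      ENNReal.zero_rpow_of_pos hε, zero_mul]

theorem lintegral_dyadicMax_zero_rpow_mul (hh : 0 < h)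
    (hv : ∀ Q, IsCube Q → ∫⁻ y in Q, v y ≠ ∞) {ε : ℝ} (hε : 0 < ε) :
    ∫⁻ x, dyadicMax a h v 0 x ^ ε * v x =
      cubeAvg v (dyadicCube a h 0 0) ^ ε * ∫⁻ x in dyadicCube a h 0 0, v x := by
  simp_rw [dyadicMax_zero_rpow_mul hε]
  rw [lintegral_indicator (measurable_dyadicIndex 0 (measurableSet_singleton _)),
    lintegral_const_mul', setLIntegral_congr (dyadicIndex_preimage_ae_eq hh 0 _)]
  exact ENNReal.rpow_ne_top_of_nonneg hε.le (ENNReal.div_ne_top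
    (hv _ (isCube_dyadicCube hh _ _)) (volume_dyadicCube_ne_zero hh _ _))

theorem lintegral_dyadicMax_rpow_mul_ne_top (hh : 0 < h)
    (hv : ∀ Q, IsCube Q → ∫⁻ y in Q, v y ≠ ∞) {ε : ℝ} (hε : 0 < ε) (k : ℕ) :
    ∫⁻ x, dyadicMax a h v k x ^ ε * v x ≠ ∞ := by
  have hc : ((2 ^ n : ℝ≥0∞) ^ k) ^ ε ≠ ∞ := ENNReal.rpow_ne_top_of_nonneg hε.le (by finiteness)
  have hle : ∫⁻ x, dyadicMax a h v k x ^ ε * v x ≤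
      ((2 ^ n) ^ k) ^ ε * ∫⁻ x, dyadicMax a h v 0 x ^ ε * v x := by
    rw [← lintegral_const_mul' _ _ hc]
    refine lintegral_mono fun x => ?_
    simp only
    rw [← mul_assoc, ← ENNReal.mul_rpow_of_nonneg _ _ hε.le]
    gcongr
    exact dyadicMax_le_zero hh k x
  refine ne_top_of_le_ne_top (ENNReal.mul_ne_top hc ?_) hle
  have hQ := hv _ (isCube_dyadicCube (a := a) hh 0 0)
  rw [lintegral_dyadicMax_zero_rpow_mul hh hv hε]
  exact ENNReal.mul_ne_top (ENNReal.rpow_ne_top_of_nonneg hε.le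
    (ENNReal.div_ne_top hQ (volume_dyadicCube_ne_zero hh _ _))) hQ

theorem lintegral_dyadicMax_rpow_mul_le (hh : 0 < h) (hvm : AEMeasurable v)
    (hv : ∀ Q, IsCube Q → ∫⁻ y in Q, v y ≠ ∞) {A : ℝ≥0∞}
    (hA : ∀ Q, IsCube Q → ∫⁻ x in Q, hlM (Q.indicator v) x ≤ A * ∫⁻ x in Q, v x)
    {ε : ℝ} (hε : 0 < ε) (hε1 : ε ≤ 1) (hεA : ENNReal.ofReal (2 ^ n * ε) * A ≤ 2⁻¹) (k : ℕ) :
    ∫⁻ x, dyadicMax a h v k x ^ ε * v x ≤ 2 * ∫⁻ x, dyadicMax a h v 0 x ^ ε * v x := by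
  set I := ∫⁻ x, dyadicMax a h v k x ^ ε * v x
  set I₀ := ∫⁻ x, dyadicMax a h v 0 x ^ ε * v x
  have hI : I ≠ ∞ := lintegral_dyadicMax_rpow_mul_ne_top hh hv hε k
  have h1 : I ≤ I₀ + 2⁻¹ * I := by
    refine (lintegral_dyadicMax_rpow_mul_le_add hh hvm hv hε.le hε1 k).trans ?_
    refine add_le_add_right ?_ _
    calc _ ≤ ENNReal.ofReal (2 ^ n * ε) * (A * I) := by
          gcongr
          exact lintegral_dyadicMax_rpow_mul_dyadicMax_le hh hvm hv hA hε.le le_rfl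
      _ ≤ _ := by
          rw [← mul_assoc]
          gcongr
  have h2 : 2⁻¹ * I + 2⁻¹ * I = I := by rw [← add_mul, ENNReal.inv_two_add_inv_two, one_mul]
  have h3 : 2⁻¹ * I ≤ I₀ := by
    rw [← ENNReal.add_le_add_iff_right (a := 2⁻¹ * I) (ENNReal.mul_ne_top (by simp) hI), h2]
    exact h1
  calc I = 2 * (2⁻¹ * I) := by
        rw [← mul_assoc, ENNReal.mul_inv_cancel (by simp) (by simp), one_mul]
    _ ≤ 2 * I₀ := by gcongr

theorem setLIntegral_rpow_mul_le (hh : 0 < h) (hvm : AEMeasurable v) (hv_top : ∀ x, v x ≠ ∞)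
    (hv : ∀ Q, IsCube Q → ∫⁻ y in Q, v y ≠ ∞) {A : ℝ≥0∞}
    (hA : ∀ Q, IsCube Q → ∫⁻ x in Q, hlM (Q.indicator v) x ≤ A * ∫⁻ x in Q, v x)
    {ε : ℝ} (hε : 0 < ε) (hε1 : ε ≤ 1) (hεA : ENNReal.ofReal (2 ^ n * ε) * A ≤ 2⁻¹) :
    ∫⁻ x in dyadicCube a h 0 0, v x ^ ε * v x ≤
      2 * (cubeAvg v (dyadicCube a h 0 0) ^ ε * ∫⁻ x in dyadicCube a h 0 0, v x) := by
  have hQm : MeasurableSet (dyadicIndex a h 0 ⁻¹' {0}) :=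
    measurable_dyadicIndex 0 (measurableSet_singleton _)
  rw [← setLIntegral_congr (dyadicIndex_preimage_ae_eq hh 0 0) (f := fun x => v x ^ ε * v x),
    ← lintegral_dyadicMax_zero_rpow_mul hh hv hε]
  calc ∫⁻ x in dyadicIndex a h 0 ⁻¹' {0}, v x ^ ε * v x
      ≤ ∫⁻ x in dyadicIndex a h 0 ⁻¹' {0},
          Filter.liminf (fun k => dyadicMax a h v k x ^ ε * v x) Filter.atTop := by
        refine setLIntegral_mono_ae' hQm ?_
        filter_upwards [ae_tendsto_dyadicAvg hh hvm hv] with x hx hxQ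
        have hlim := ENNReal.Tendsto.mul_const (((ENNReal.continuous_rpow_const (y := ε)).tendsto
          (v x)).comp (hx hxQ)) (Or.inr (hv_top x))
        rw [← hlim.liminf_eq]
        refine Filter.liminf_le_liminf (.of_forall fun k => ?_)
        simp only [Function.comp_apply]
        gcongr
        simpa only [Set.indicator_of_mem hxQ] using
          indicator_dyadicAvg_le_dyadicMax (a := a) (h := h) (v := v) k x
    _ ≤ Filter.liminf (fun k => ∫⁻ x in dyadicIndex a h 0 ⁻¹' {0},
          dyadicMax a h v k x ^ ε * v x) Filter.atTop :=
        lintegral_liminf_le' fun k =>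
          (measurable_dyadicMax_rpow ε k).aemeasurable.mul hvm.restrict
    _ ≤ 2 * ∫⁻ x, dyadicMax a h v 0 x ^ ε * v x := by
        refine Filter.liminf_le_of_le (by isBoundedDefault) fun b hb => ?_
        obtain ⟨k, hk⟩ := hb.exists
        exact hk.trans ((setLIntegral_le_lintegral _ _).trans
          (lintegral_dyadicMax_rpow_mul_le hh hvm hv hA hε hε1 hεA k))

end DyadicGrid

theorem wMeas_ne_zero {n : ℕ} {w : (Fin n → ℝ) → ℝ} (hw : IsWeight w) {Q : Set (Fin n → ℝ)}
    (hQ : IsCube Q) : wMeas w Q ≠ 0 := by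
  obtain ⟨a, h, hh, rfl⟩ := hQ
  intro h0
  rw [wMeas, lintegral_eq_zero_iff' hw.1.aestronglyMeasurable.aemeasurable.ennreal_ofReal.restrict]
    at h0
  have hfalse : ∀ᵐ x ∂volume.restrict {x : Fin n → ℝ | ∀ i, a i ≤ x i ∧ x i ≤ a i + h}, False := by
    filter_upwards [h0, ae_restrict_of_ae hw.2] with x hx hx'
    exact absurd (ENNReal.ofReal_eq_zero.1 hx) (not_le.2 hx')
  rw [Filter.eventually_false_iff_eq_bot, ae_eq_bot, Measure.restrict_eq_zero] at hfalse
  have : {x : Fin n → ℝ | ∀ i, a i ≤ x i ∧ x i ≤ a i + h} = dyadicCube a h 0 0 := by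
    ext x; simp [dyadicCube, Pi.le_def, forall_and]
  exact volume_dyadicCube_ne_zero hh 0 0 (this ▸ hfalse)

theorem setLIntegral_ofReal_ne_top_of_isCube {n : ℕ} {w : (Fin n → ℝ) → ℝ} (hw : IsWeight w)
    {Q : Set (Fin n → ℝ)} (hQ : IsCube Q) : ∫⁻ x in Q, ENNReal.ofReal (w x) ≠ ∞ := by
  obtain ⟨a, h, hh, rfl⟩ := hQ
  have : {x : Fin n → ℝ | ∀ i, a i ≤ x i ∧ x i ≤ a i + h} = Set.Icc a fun i => a i + h := by
    ext x; simp [Pi.le_def, forall_and]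
  rw [this]
  exact (hw.1.integrableOn_isCompact isCompact_Icc).lintegral_lt_top.ne

theorem setLIntegral_hlM_le_aInfConst_mul {n : ℕ} {w : (Fin n → ℝ) → ℝ} (hw : IsWeight w)
    {Q : Set (Fin n → ℝ)} (hQ : IsCube Q) :
    ∫⁻ x in Q, hlM (Q.indicator fun y => ENNReal.ofReal (w y)) x ≤
      aInfConst w * ∫⁻ x in Q, ENNReal.ofReal (w x) := by
  refine (ENNReal.div_le_iff (wMeas_ne_zero hw hQ)
    (setLIntegral_ofReal_ne_top_of_isCube hw hQ)).1 ?_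
  exact le_iSup₂_of_le Q hQ le_rfl

theorem one_le_aInfConst {n : ℕ} {w : (Fin n → ℝ) → ℝ} (hw : IsWeight w) : 1 ≤ aInfConst w := by
  have hQ : IsCube (dyadicCube (0 : Fin n → ℝ) 1 0 0) := isCube_dyadicCube one_pos 0 0
  set Q := dyadicCube (0 : Fin n → ℝ) 1 0 0
  have hQm : MeasurableSet Q := measurableSet_Icc
  have key : 1 * wMeas w Q ≤ aInfConst w * wMeas w Q := by
    refine le_trans ?_ (setLIntegral_hlM_le_aInfConst_mul hw hQ)
    calc 1 * wMeas w Q = ∫⁻ _ in Q, cubeAvg (fun y => ENNReal.ofReal (w y)) Q := by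
          rw [setLIntegral_const, cubeAvg, ENNReal.div_mul_cancel
            (volume_dyadicCube_ne_zero one_pos _ _) (volume_dyadicCube_ne_top _ _), one_mul, wMeas]
      _ ≤ _ := by
          refine setLIntegral_mono' hQm fun x hx => ?_
          refine le_iSup₂_of_le Q hQ (le_iSup_of_le hx (le_of_eq ?_))
          rw [cubeAvg, cubeAvg]
          congr 1
          exact setLIntegral_congr_fun hQm fun y hy =>
            (Set.indicator_of_mem hy fun y => ENNReal.ofReal (w y)).symm
  exact (ENNReal.mul_le_mul_iff_left (wMeas_ne_zero hw hQ)
    (setLIntegral_ofReal_ne_top_of_isCube hw hQ)).1 key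

/-- **Sharp reverse Hölder inequality for `A_∞`.** There is a dimensional constant `τ_n`
such that for every `w ∈ A_∞`, with `r_w = 1 + 1/(τ_n [w]_{A_∞})`, every cube `Q` satisfies
`(⟨w^{r_w}⟩_Q)^{1/r_w} ≤ 2 ⟨w⟩_Q`. -/
theorem sharp_reverse_holder (n : ℕ) :
    ∃ τ : ℝ, 0 < τ ∧
      ∀ w : (Fin n → ℝ) → ℝ, IsWeight w → aInfConst w ≠ ∞ →
        ∀ Q : Set (Fin n → ℝ), IsCube Q →
          (cubeAvg (fun y => ENNReal.ofReal (w y) ^ (1 + 1 / (τ * (aInfConst w).toReal))) Q) ^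
              (1 / (1 + 1 / (τ * (aInfConst w).toReal))) ≤
            2 * cubeAvg (fun y => ENNReal.ofReal (w y)) Q := by
  refine ⟨2 ^ (n + 1), by positivity, fun w hw hA Q hQ => ?_⟩
  obtain ⟨a, h, hh, hQ_eq⟩ := hQ
  obtain rfl : Q = dyadicCube a h 0 0 := by
    rw [hQ_eq]
    ext x
    simp [dyadicCube, Pi.le_def, forall_and]
  have hA1 : 1 ≤ (aInfConst w).toReal := by
    simpa using ENNReal.toReal_mono hA (one_le_aInfConst hw)
  set ε : ℝ := 1 / (2 ^ (n + 1) * (aInfConst w).toReal) with hε_def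
  have hε : 0 < ε := by positivity
  have hε1 : ε ≤ 1 := by
    rw [hε_def, div_le_one (by positivity)]
    exact one_le_mul_of_one_le_of_one_le (one_le_pow₀ one_le_two) hA1
  have hεA : ENNReal.ofReal (2 ^ n * ε) * aInfConst w ≤ 2⁻¹ := by
    rw [← ENNReal.ofReal_toReal hA, ← ENNReal.ofReal_mul (by positivity),
      ← ENNReal.ofReal_ofNat, ← ENNReal.ofReal_inv_of_pos (by norm_num)]
    refine ENNReal.ofReal_le_ofReal (le_of_eq ?_)
    rw [hε_def, pow_succ]
    field_simp
  have key := setLIntegral_rpow_mul_le (a := a) hh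
    hw.1.aestronglyMeasurable.aemeasurable.ennreal_ofReal (fun _ => ENNReal.ofReal_ne_top)
    (fun Q hQ => setLIntegral_ofReal_ne_top_of_isCube hw hQ)
    (fun Q hQ => setLIntegral_hlM_le_aInfConst_mul hw hQ) hε hε1 hεA
  have hadd : ∀ t : ℝ≥0∞, t ^ (1 + ε) = t ^ ε * t := fun t => by
    rw [add_comm, ENNReal.rpow_add_of_nonneg _ _ hε.le zero_le_one, ENNReal.rpow_one]
  rw [one_div, ENNReal.rpow_inv_le_iff (by positivity),
    ENNReal.mul_rpow_of_nonneg _ _ (by positivity)]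
  simp_rw [hadd]
  calc cubeAvg (fun y => ENNReal.ofReal (w y) ^ ε * ENNReal.ofReal (w y)) (dyadicCube a h 0 0)
      ≤ 2 * (cubeAvg (fun y => ENNReal.ofReal (w y)) (dyadicCube a h 0 0) ^ ε *
          cubeAvg (fun y => ENNReal.ofReal (w y)) (dyadicCube a h 0 0)) := by
        refine (ENNReal.div_le_div_right key _).trans_eq ?_
        rw [mul_div_assoc, mul_div_assoc]
        rfl
    _ ≤ _ := by
        gcongr
        exact le_mul_of_one_le_left' (ENNReal.one_le_rpow one_le_two hε)
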